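/- Let δ ∈ (0, 1/6) be fixed. Then #𝓔_δ(X) ≪ X^{5/6 − 5δ/6}, with implied constant depending only on δ. -/

import Mathlib

/-- The set `𝓔_δ(X)` of quadruples `(A, B, m, ℓ)` of nonzero integers (with `ℓ ≥ 1`) such that
`|A|³ ≤ X`, `B² ≤ X`, `ℓ > X^δ` and `4A³ + 27B² = mℓ²`. -/
def Eset (δ X : ℝ) : Set (ℤ × ℤ × ℤ × ℤ) :=
  {t | t.1 ≠ 0 ∧ t.2.1 ≠ 0 ∧ t.2.2.1 ≠ 0 ∧ 1 ≤ t.2.2.2 ∧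
    (|t.1| ^ 3 : ℝ) ≤ X ∧ ((t.2.1 : ℝ) ^ 2 : ℝ) ≤ X ∧ X ^ δ < (t.2.2.2 : ℝ) ∧
    4 * t.1 ^ 3 + 27 * t.2.1 ^ 2 = t.2.2.1 * t.2.2.2 ^ 2}

/-- The subset `𝓔_δ^{(1)}(X)` where moreover `ℓ > X^{1/3}`. -/
def Eset1 (δ X : ℝ) : Set (ℤ × ℤ × ℤ × ℤ) :=
  {t ∈ Eset δ X | X ^ ((1 : ℝ) / 3) < (t.2.2.2 : ℝ)}

/-- The subset `𝓔_δ^{(2)}(X) = 𝓔_δ(X) ∖ 𝓔_δ^{(1)}(X)`. -/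
def Eset2 (δ X : ℝ) : Set (ℤ × ℤ × ℤ × ℤ) := Eset δ X \ Eset1 δ X

/-- The divisor bound: `τ(n) ≪ n ^ ε` for every `ε > 0`. -/
theorem exists_card_divisors_le_rpow {ε : ℝ} (hε : 0 < ε) :
    ∃ C : ℝ, 1 ≤ C ∧ ∀ n : ℕ, n ≠ 0 → (n.divisors.card : ℝ) ≤ C * (n : ℝ) ^ ε := by
  set s : ℝ := (2 : ℝ) ^ ε with hs
  have hs1 : 1 < s := Real.one_lt_rpow (by norm_num) hε
  set K : ℝ := 1 + 1 / (s - 1) with hK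
  have hK1 : 1 ≤ K := by
    have : 0 < 1 / (s - 1) := one_div_pos.2 (by linarith)
    linarith
  obtain ⟨P, hP⟩ := exists_nat_ge ((2 : ℝ) ^ (1 / ε))
  refine ⟨K ^ P, one_le_pow₀ hK1, fun n hn => ?_⟩
  rw [Nat.card_divisors hn]
  have hpow : (n : ℝ) ^ ε = ∏ p ∈ n.primeFactors, ((p : ℝ) ^ ε) ^ n.factorization p := by
    conv_lhs => rw [← Nat.prod_factorization_pow_eq_self hn]
    rw [Nat.prod_factorization_eq_prod_primeFactors]
    push_cast
    rw [← Real.finsetProd_rpow _ _ (fun _ _ => by positivity)]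
    refine Finset.prod_congr rfl fun p _ => ?_
    rw [← Real.rpow_natCast, ← Real.rpow_natCast, ← Real.rpow_mul (by positivity),
      ← Real.rpow_mul (by positivity), mul_comm]
  have hloc : ∀ p ∈ n.primeFactors, ((n.factorization p + 1 : ℕ) : ℝ) ≤
      (if p < P then K else 1) * ((p : ℝ) ^ ε) ^ n.factorization p := by
    intro p hp
    have hp2 : (2 : ℝ) ≤ p := by exact_mod_cast (Nat.prime_of_mem_primeFactors hp).two_le
    set a := n.factorization p
    push_cast
    split_ifs with h
    · have h1 : s ^ a ≤ ((p : ℝ) ^ ε) ^ a := by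
        rw [hs]
        gcongr
      have h2 : 1 + (a : ℝ) * (s - 1) ≤ s ^ a := by
        have := one_add_mul_le_pow (a := s - 1) (by linarith) a
        simpa using this
      have h3 : (a : ℝ) + 1 ≤ K * (1 + (a : ℝ) * (s - 1)) := by
        have : K * (1 + (a : ℝ) * (s - 1)) = K + a * (s - 1) + a := by
          rw [hK]; field_simp [(by linarith : s - 1 ≠ 0)]; ring
        have h4 : 0 ≤ (a : ℝ) * (s - 1) := mul_nonneg (by positivity) (by linarith)
        linarith
      calc (a : ℝ) + 1 ≤ K * (1 + (a : ℝ) * (s - 1)) := h3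
        _ ≤ K * ((p : ℝ) ^ ε) ^ a := by gcongr; linarith
    · have h1 : (2 : ℝ) ≤ (p : ℝ) ^ ε := by
        have : (2 : ℝ) = ((2 : ℝ) ^ (1 / ε)) ^ ε := by
          rw [← Real.rpow_mul (by norm_num)]; field_simp; simp
        rw [this]
        have hPp : (P : ℝ) ≤ p := by exact_mod_cast not_lt.1 h
        gcongr
        linarith
      have h2 : (a : ℝ) + 1 ≤ 2 ^ a := by exact_mod_cast Nat.lt_two_pow_self
      rw [one_mul]
      exact h2.trans (by gcongr)
  calc ((∏ p ∈ n.primeFactors, (n.factorization p + 1) : ℕ) : ℝ)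
      = ∏ p ∈ n.primeFactors, ((n.factorization p + 1 : ℕ) : ℝ) := by push_cast; rfl
    _ ≤ ∏ p ∈ n.primeFactors, (if p < P then K else 1) * ((p : ℝ) ^ ε) ^ n.factorization p :=
        Finset.prod_le_prod (fun _ _ => by positivity) hloc
    _ = (∏ p ∈ n.primeFactors, (if p < P then K else 1)) * (n : ℝ) ^ ε := by
        rw [Finset.prod_mul_distrib, hpow]
    _ ≤ K ^ P * (n : ℝ) ^ ε := by
        gcongr
        rw [Finset.prod_ite, Finset.prod_const, Finset.prod_const_one, mul_one]
        refine pow_le_pow_right₀ hK1 ?_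
        calc _ ≤ (Finset.range P).card := Finset.card_le_card fun p hp => by
              simpa using (Finset.mem_filter.1 hp).2
          _ = P := Finset.card_range P

/-- An arithmetic progression of difference `M` meets `[-Z, Z]` in at most `2 Z / M + 1` points. -/
theorem card_le_of_pairwise_modEq {S : Finset ℤ} {M Z : ℕ} (hM : 0 < M)
    (hZ : ∀ x ∈ S, |x| ≤ Z) (hmod : ∀ x ∈ S, ∀ y ∈ S, (M : ℤ) ∣ x - y) :
    (S.card : ℝ) ≤ 1 + 2 * Z / M := by
  have h : S.card ≤ (Finset.range (2 * Z / M + 1)).card := by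
    refine Finset.card_le_card_of_injOn (fun x => ((x + Z) / M).toNat) ?_ ?_
    · intro x hx
      have h1 := abs_le.1 (hZ x hx)
      simp only [Finset.coe_range, Set.mem_Iio]
      have h2 : (x + Z) / M ≤ (2 * Z : ℤ) / M := Int.ediv_le_ediv (by exact_mod_cast hM) (by linarith)
      have h3 : ((2 * Z / M : ℕ) : ℤ) = (2 * Z : ℤ) / M := by norm_cast
      have h4 : 0 ≤ (x + Z) / M := Int.ediv_nonneg (by linarith) (by positivity)
      rw [← h3] at h2
      omega
    · intro x hx y hy hxy
      have h1 := abs_le.1 (hZ x hx)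
      have h2 := abs_le.1 (hZ y hy)
      have hM' : (0 : ℤ) < M := by exact_mod_cast hM
      have h3 : 0 ≤ (x + Z) / M := Int.ediv_nonneg (by linarith) hM'.le
      have h4 : 0 ≤ (y + Z) / M := Int.ediv_nonneg (by linarith) hM'.le
      have h5 : (x + Z) / M = (y + Z) / M := by
        simp only at hxy; omega
      have h6 : (x + Z) % M = (y + Z) % M :=
        Int.emod_eq_emod_iff_emod_sub_eq_zero.2
          (Int.emod_eq_zero_of_dvd (by simpa using hmod x hx y hy))
      have h7 := Int.mul_ediv_add_emod (x + Z) M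
      have h8 := Int.mul_ediv_add_emod (y + Z) M
      rw [h5, h6] at h7
      linarith
  rw [Finset.card_range] at h
  calc (S.card : ℝ) ≤ ((2 * Z / M + 1 : ℕ) : ℝ) := by exact_mod_cast h
    _ ≤ 1 + 2 * Z / M := by
      push_cast
      have := @Nat.cast_div_le ℝ _ _ _ (2 * Z) M
      push_cast at this
      linarith

/-- There are at most `2 N / d` nonzero multiples of `d` in `[-N, N]`. -/
theorem card_nonzero_multiples_le {S : Finset ℤ} {d : ℕ} {N : ℝ} (hd : 0 < d) (hN : 0 ≤ N)
    (hS : ∀ x ∈ S, x ≠ 0 ∧ (d : ℤ) ∣ x ∧ |(x : ℝ)| ≤ N) :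
    (S.card : ℝ) ≤ 2 * N / d := by
  have hd' : (0 : ℝ) < d := by exact_mod_cast hd
  set k := ⌊N / d⌋₊ with hk
  have h : S.card ≤ ((Finset.Icc (-(k : ℤ)) k).erase 0).card := by
    refine Finset.card_le_card_of_injOn (fun x => x / d) ?_ ?_
    · intro x hx
      obtain ⟨h0, ⟨y, rfl⟩, hxN⟩ := hS x hx
      have hy : y ≠ 0 := by rintro rfl; simp at h0
      have hdz : (d : ℤ) ≠ 0 := by exact_mod_cast hd.ne'
      have h1 : y.natAbs ≤ k := by
        apply Nat.le_floor
        rw [le_div_iff₀ hd', Nat.cast_natAbs, Int.cast_abs]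
        push_cast at hxN
        rwa [abs_mul, abs_of_pos hd', mul_comm] at hxN
      simp only [Int.mul_ediv_cancel_left _ hdz, Finset.coe_erase, Finset.coe_Icc,
        Set.mem_sdiff, Set.mem_Icc, Set.mem_singleton_iff]
      omega
    · intro x hx y hy hxy
      obtain ⟨-, ⟨u, rfl⟩, -⟩ := hS x hx
      obtain ⟨-, ⟨v, rfl⟩, -⟩ := hS y hy
      have hdz : (d : ℤ) ≠ 0 := by exact_mod_cast hd.ne'
      simp only [Int.mul_ediv_cancel_left _ hdz] at hxy
      rw [hxy]
  have h2 : ((Finset.Icc (-(k : ℤ)) k).erase 0).card = 2 * k := by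
    rw [Finset.card_erase_of_mem (by simp), Int.card_Icc]
    omega
  rw [h2] at h
  have h3 : (k : ℝ) ≤ N / d := Nat.floor_le (by positivity)
  calc (S.card : ℝ) ≤ ((2 * k : ℕ) : ℝ) := by exact_mod_cast h
    _ ≤ 2 * (N / d) := by push_cast; linarith
    _ = 2 * N / d := by ring

/-- The number of square roots of `c` modulo `q` in `[-Z, Z]`. -/
theorem card_sqrt_mod_le {S : Finset ℤ} {q Z : ℕ} {c : ℤ} {H : ℝ} (hq : 0 < q)
    (hZ : ∀ x ∈ S, |x| ≤ Z) (hS : ∀ x ∈ S, (q : ℤ) ∣ x ^ 2 - c)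
    (hH : ∀ h : ℕ, h ^ 2 ∣ q → ((h : ℤ) ^ 2) ∣ 4 * c → (h : ℝ) ≤ H) :
    (S.card : ℝ) ≤ q.divisors.card * (1 + 2 * Z * H / q) := by
  have hH1 : 1 ≤ H := by simpa using hH 1 (by simp) (by simp)
  rcases S.eq_empty_or_nonempty with rfl | ⟨x₀, hx₀⟩
  · simp only [Finset.card_empty, Nat.cast_zero]; positivity
  rw [Finset.card_eq_sum_card_fiberwise (f := fun x => Int.gcd q (x - x₀)) (t := q.divisors)]
  swap
  · intro x _
    simp only [Finset.mem_coe, Nat.mem_divisors]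
    exact ⟨by exact_mod_cast Int.gcd_dvd_left (q : ℤ) (x - x₀), hq.ne'⟩
  rw [Nat.cast_sum, ← nsmul_eq_mul]
  refine Finset.sum_le_card_nsmul _ _ _ fun d hd => ?_
  obtain ⟨⟨e, rfl⟩, -⟩ := Nat.mem_divisors.1 hd
  set F := {x ∈ S | Int.gcd ((d * e : ℕ) : ℤ) (x - x₀) = d} with hF
  have hd0 : 0 < d := Nat.pos_of_mul_pos_right hq
  have he0 : 0 < e := Nat.pos_of_mul_pos_left hq
  have hFd : ∀ x ∈ F, (d : ℤ) ∣ x - x₀ ∧ (e : ℤ) ∣ x + x₀ := by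
    intro x hx
    obtain ⟨hxS, hxd⟩ := Finset.mem_filter.1 hx
    refine ⟨?_, ?_⟩
    · conv_lhs => rw [← hxd]
      exact Int.gcd_dvd_right ..
    · have h1 : ((d * e : ℕ) : ℤ) ∣ (x - x₀) * (x + x₀) := by
        rw [show (x - x₀) * (x + x₀) = (x ^ 2 - c) - (x₀ ^ 2 - c) by ring]
        exact dvd_sub (hS x hxS) (hS x₀ hx₀)
      have h2 : ((d * e : ℕ) : ℤ) ∣ (d : ℤ) * (x + x₀) := by
        have := dvd_gcd_mul_of_dvd_mul h1
        rwa [← Int.coe_gcd, hxd] at this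
      push_cast at h2
      exact Int.dvd_of_mul_dvd_mul_left (by exact_mod_cast hd0.ne') h2
  rcases F.eq_empty_or_nonempty with hFe | ⟨x₁, hx₁⟩
  · rw [hFe]; simp only [Finset.card_empty, Nat.cast_zero]; positivity
  have hh : ((Nat.gcd d e : ℕ) : ℝ) ≤ H := by
    have hsq : (Nat.gcd d e) ^ 2 ∣ d * e := by
      rw [sq]; exact mul_dvd_mul (Nat.gcd_dvd_left d e) (Nat.gcd_dvd_right d e)
    refine hH _ hsq ?_
    have hg1 : ((Nat.gcd d e : ℕ) : ℤ) ∣ x₁ - x₀ :=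
      (Int.natCast_dvd_natCast.2 (Nat.gcd_dvd_left d e)).trans (hFd x₁ hx₁).1
    have hg2 : ((Nat.gcd d e : ℕ) : ℤ) ∣ x₁ + x₀ :=
      (Int.natCast_dvd_natCast.2 (Nat.gcd_dvd_right d e)).trans (hFd x₁ hx₁).2
    have hg3 : ((Nat.gcd d e : ℕ) : ℤ) ∣ 2 * x₀ := by
      rw [show 2 * x₀ = (x₁ + x₀) - (x₁ - x₀) by ring]
      exact dvd_sub hg2 hg1
    have hg4 : ((Nat.gcd d e : ℕ) : ℤ) ^ 2 ∣ x₀ ^ 2 - c :=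
      (by exact_mod_cast Int.natCast_dvd_natCast.2 hsq : ((Nat.gcd d e : ℕ) : ℤ) ^ 2 ∣
        ((d * e : ℕ) : ℤ)).trans (hS x₀ hx₀)
    rw [show 4 * c = (2 * x₀) ^ 2 - 4 * (x₀ ^ 2 - c) by ring]
    exact dvd_sub (pow_dvd_pow_of_dvd hg3 2) (hg4.mul_left 4)
  have hM : 0 < Nat.lcm d e := Nat.lcm_pos hd0 he0
  have hcard : (F.card : ℝ) ≤ 1 + 2 * Z / (Nat.lcm d e : ℕ) := by
    refine card_le_of_pairwise_modEq hM (fun x hx => hZ x (Finset.mem_filter.1 hx).1) ?_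
    intro x hx y hy
    have h1 : (d : ℤ) ∣ x - y := by
      rw [show x - y = (x - x₀) - (y - x₀) by ring]
      exact dvd_sub (hFd x hx).1 (hFd y hy).1
    have h2 : (e : ℤ) ∣ x - y := by
      rw [show x - y = (x + x₀) - (y + x₀) by ring]
      exact dvd_sub (hFd x hx).2 (hFd y hy).2
    have := lcm_dvd h1 h2
    rwa [← Int.coe_lcm, Int.lcm_natCast_natCast] at this
  refine hcard.trans ?_
  have hmul : ((d * e : ℕ) : ℝ) = (Nat.gcd d e : ℕ) * (Nat.lcm d e : ℕ) := by
    exact_mod_cast (Nat.gcd_mul_lcm d e).symm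
  have hM' : (0 : ℝ) < (Nat.lcm d e : ℕ) := by exact_mod_cast hM
  have hg' : (0 : ℝ) < (Nat.gcd d e : ℕ) := by exact_mod_cast Nat.gcd_pos_of_pos_left e hd0
  rw [hmul]
  have : 2 * (Z : ℝ) / (Nat.lcm d e : ℕ) =
      2 * Z * (Nat.gcd d e : ℕ) / ((Nat.gcd d e : ℕ) * (Nat.lcm d e : ℕ)) := by
    field_simp
  rw [this]
  gcongr

/-- Two solutions of a Pell equation of comparable size coincide up to sign. -/
theorem pell_eq_of_lt_two_mul {D a b c d : ℤ} (hD : D ≠ 0) (ha : 0 ≤ a) (hc : 0 ≤ c)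
    (hd : 0 ≤ d) (h₁ : a ^ 2 - D * c ^ 2 = 1) (h₂ : b ^ 2 - D * d ^ 2 = 1)
    (hab : a ≤ b) (hba : b < 2 * a ∨ a = b) : a = b ∧ c = d := by
  have hfin : a = b → a = b ∧ c = d := by
    rintro rfl
    refine ⟨rfl, ?_⟩
    have h3 : D * c ^ 2 = D * d ^ 2 := by linarith
    have h4 := mul_left_cancel₀ hD h3
    exact (pow_left_inj₀ hc hd two_ne_zero).1 h4
  rcases hba with hba | hab'
  swap
  · exact hfin hab'
  rcases hab.eq_or_lt with hab' | hlt
  · exact hfin hab'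
  exfalso
  have ha2 : 2 ≤ a := by omega
  have hDpos : 0 < D := by
    rcases lt_or_gt_of_ne hD with h | h
    · nlinarith [sq_nonneg d]
    · exact h
  have hz : a * d - b * c ≠ 0 := by
    intro hz
    have h3 : (a * d) ^ 2 = (b * c) ^ 2 := by rw [sub_eq_zero.1 hz]
    have h4 : d ^ 2 = c ^ 2 := by
      have h5 : a ^ 2 = 1 + D * c ^ 2 := by linarith
      have h6 : b ^ 2 = 1 + D * d ^ 2 := by linarith
      rw [mul_pow, mul_pow, h5, h6] at h3
      linarith
    have h5 : a ^ 2 = b ^ 2 := by rw [h4] at h₂; linarith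
    nlinarith
  have hw : (a * b - D * c * d) ^ 2 - D * (a * d - b * c) ^ 2 = 1 := by
    have : (a * b - D * c * d) ^ 2 - D * (a * d - b * c) ^ 2 =
      (a ^ 2 - D * c ^ 2) * (b ^ 2 - D * d ^ 2) := by ring
    rw [this, h₁, h₂, one_mul]
  have hz2 : 1 ≤ (a * d - b * c) ^ 2 := by
    have := pow_pos (abs_pos.2 hz) 2
    rw [sq_abs] at this
    omega
  have hw2 : 2 ≤ (a * b - D * c * d) ^ 2 := by nlinarith
  have hprod : (D * c * d) ^ 2 = (a ^ 2 - 1) * (b ^ 2 - 1) := by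
    have h5 : D * c ^ 2 = a ^ 2 - 1 := by linarith
    have h6 : D * d ^ 2 = b ^ 2 - 1 := by linarith
    rw [← h5, ← h6]; ring
  have hnn : 0 ≤ D * c * d := by positivity
  have hwpos : D * c * d < a * b := by
    apply lt_of_pow_lt_pow_left₀ 2 (by nlinarith)
    rw [hprod]; nlinarith
  have hw3 : 2 ≤ a * b - D * c * d := by
    by_contra hcon
    have : a * b - D * c * d = 1 := by omega
    rw [this] at hw2
    norm_num at hw2
  have h7 : (D * c * d) ^ 2 ≤ (a * b - 2) ^ 2 := by
    apply pow_le_pow_left₀ hnn; linarith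
  rw [hprod] at h7
  nlinarith [mul_pos (sub_pos.2 hlt) (by linarith : 0 < 3 * a - b)]

/-- The number of solutions of a Pell equation up to height `V` is `O(log V)`. -/
theorem card_pell_le {S : Finset (ℤ × ℤ)} {D : ℤ} {V : ℕ} (hD : D ≠ 0)
    (hS : ∀ p ∈ S, p.1 ^ 2 - D * p.2 ^ 2 = 1) (hV : ∀ p ∈ S, |p.1| ≤ V) :
    S.card ≤ 4 * (V.size + 1) := by
  have h : S.card ≤
      ((Finset.univ : Finset (Bool × Bool)) ×ˢ Finset.range (V.size + 1)).card := by
    refine Finset.card_le_card_of_injOn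
      (fun p => ((decide (0 ≤ p.1), decide (0 ≤ p.2)), p.1.natAbs.size)) ?_ ?_
    · intro p hp
      have h1 := hV p hp
      rw [Int.abs_eq_natAbs] at h1
      have h2 : p.1.natAbs.size ≤ V.size := Nat.size_le_size (by omega)
      simp only [Finset.coe_product, Finset.coe_univ, Finset.coe_range, Set.mem_prod,
        Set.mem_univ, Set.mem_Iio, true_and]
      omega
    · have key : ∀ p ∈ S, ∀ p' ∈ S, p.1.natAbs.size = p'.1.natAbs.size →
          |p.1| ≤ |p'.1| → |p.1| = |p'.1| ∧ |p.2| = |p'.2| := by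
        intro p hp p' hp' hsize hle
        refine pell_eq_of_lt_two_mul hD (abs_nonneg _) (abs_nonneg _) (abs_nonneg _)
          (by simpa using hS p hp) (by simpa using hS p' hp') hle ?_
        rw [Int.abs_eq_natAbs, Int.abs_eq_natAbs]
        have h1 : p'.1.natAbs < 2 ^ p'.1.natAbs.size := Nat.lt_size_self _
        rcases Nat.eq_zero_or_pos p'.1.natAbs.size with h0 | h0
        · right
          rw [h0] at hsize h1
          have := Nat.size_eq_zero.1 hsize
          omega
        · left
          obtain ⟨k, hk⟩ : ∃ k, p'.1.natAbs.size = k + 1 := ⟨_, (Nat.succ_pred_eq_of_pos h0).symm⟩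
          have h2 : 2 ^ k ≤ p.1.natAbs := Nat.lt_size.1 (by omega)
          rw [hk, pow_succ] at h1
          omega
      intro p hp p' hp' heq
      simp only [Prod.mk.injEq, decide_eq_decide] at heq
      obtain ⟨⟨h1, h2⟩, h3⟩ := heq
      have : |p.1| = |p'.1| ∧ |p.2| = |p'.2| := by
        rcases le_total |p.1| |p'.1| with hle | hle
        · exact key p hp p' hp' h3 hle
        · have := key p' hp' p hp h3.symm hle
          exact ⟨this.1.symm, this.2.symm⟩
      simp only [Int.abs_eq_natAbs] at this
      ext <;> omega
  simpa using h

/-- The number of primitive representations of `N` by `x² - D y²` in a box. -/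
theorem card_primitive_norm_eq_le {S : Finset (ℤ × ℤ)} {D N : ℤ} {U : ℕ} {H : ℝ} (hD : D ≠ 0)
    (hN : N ≠ 0) (hS : ∀ p ∈ S, p.1 ^ 2 - D * p.2 ^ 2 = N)
    (hU : ∀ p ∈ S, |p.1| ≤ U ∧ |p.2| ≤ U) (hcop : ∀ p ∈ S, IsCoprime p.1 p.2)
    (hH : ∀ h : ℕ, ((h : ℤ) ^ 2) ∣ 4 * D → (h : ℝ) ≤ H) :
    (S.card : ℝ) ≤ N.natAbs.divisors.card * (1 + 2 * H) *
      (4 * ((U ^ 2 * (1 + D.natAbs)).size + 1) : ℕ) := by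
  set q := N.natAbs with hq
  have hq0 : 0 < q := Int.natAbs_pos.2 hN
  have hNq : ∀ z : ℤ, (q : ℤ) ∣ z ↔ N ∣ z := fun z => Int.natAbs_dvd
  set f : ℤ × ℤ → ℤ := fun p => (p.1 * Int.gcdA p.2 q) % q with hf
  have hcopq : ∀ p ∈ S, IsCoprime N p.2 := by
    intro p hp
    rw [← hS p hp, show p.1 ^ 2 - D * p.2 ^ 2 = p.1 ^ 2 + p.2 * (-(D * p.2)) by ring]
    exact ((hcop p hp).pow_left).add_mul_left_left _
  have hfmod : ∀ p ∈ S, N ∣ p.1 - f p * p.2 := by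
    intro p hp
    rw [← hNq]
    have hg : Int.gcd p.2 q = 1 := by
      have := Int.isCoprime_iff_gcd_eq_one.1 (hcopq p hp).symm
      rwa [Int.gcd_def] at this ⊢
    have h1 := Int.gcd_eq_gcd_ab p.2 q
    rw [hg] at h1
    have h2 : (q : ℤ) ∣ p.1 * Int.gcdA p.2 q - f p := Int.dvd_self_sub_emod
    have h3 : p.1 - f p * p.2 = (p.1 * Int.gcdA p.2 q - f p) * p.2 + q * (p.1 * Int.gcdB p.2 q) := by
      push_cast at h1
      linear_combination p.1 * h1
    rw [h3]
    exact dvd_add (h2.mul_right _) (dvd_mul_right _ _)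
  have hroot : ∀ p ∈ S, N ∣ f p ^ 2 - D := by
    intro p hp
    have h1 : N ∣ (f p ^ 2 - D) * p.2 ^ 2 := by
      have h2 : (f p ^ 2 - D) * p.2 ^ 2 = N - (p.1 - f p * p.2) * (p.1 + f p * p.2) := by
        rw [← hS p hp]; ring
      rw [h2]
      exact dvd_sub dvd_rfl ((hfmod p hp).mul_right _)
    exact ((hcopq p hp).pow_right).dvd_of_dvd_mul_right h1
  have himage : ((S.image f).card : ℝ) ≤ q.divisors.card * (1 + 2 * H) := by
    have h := card_sqrt_mod_le (S := S.image f) (q := q) (Z := q) (c := D) (H := H) hq0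
      (fun x hx => ?_) (fun x hx => ?_) (fun h _ hh => hH h hh)
    · have hq' : (q : ℝ) ≠ 0 := by exact_mod_cast hq0.ne'
      convert h using 3
      field_simp
    · obtain ⟨p, -, rfl⟩ := Finset.mem_image.1 hx
      have h1 : 0 ≤ f p := Int.emod_nonneg _ (by exact_mod_cast hq0.ne')
      have h2 : f p < q := Int.emod_lt_of_pos _ (by exact_mod_cast hq0)
      rw [abs_of_nonneg h1]
      exact h2.le
    · obtain ⟨p, hp, rfl⟩ := Finset.mem_image.1 hx
      exact (hNq _).2 (hroot p hp)
  have hfiber : S.card ≤ (4 * ((U ^ 2 * (1 + D.natAbs)).size + 1)) * (S.image f).card := by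
    refine Finset.card_le_mul_card_image _ _ fun r hr => ?_
    obtain ⟨p₁, hp₁, rfl⟩ := Finset.mem_image.1 hr
    have hdiv : ∀ p ∈ S, f p = f p₁ →
        N ∣ p.1 * p₁.1 - D * p.2 * p₁.2 ∧ N ∣ p.1 * p₁.2 - p₁.1 * p.2 := by
      intro p hp hfp
      have h1 := hfmod p hp
      have h2 := hfmod p₁ hp₁
      rw [hfp] at h1
      refine ⟨?_, ?_⟩
      · have : p.1 * p₁.1 - D * p.2 * p₁.2 = (p.1 - f p₁ * p.2) * p₁.1 +
            (p₁.1 - f p₁ * p₁.2) * (f p₁ * p.2) + (f p₁ ^ 2 - D) * (p.2 * p₁.2) := by ring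
        rw [this]
        exact dvd_add (dvd_add (h1.mul_right _) (h2.mul_right _)) ((hroot p₁ hp₁).mul_right _)
      · have : p.1 * p₁.2 - p₁.1 * p.2 = (p.1 - f p₁ * p.2) * p₁.2 -
            (p₁.1 - f p₁ * p₁.2) * p.2 := by ring
        rw [this]
        exact dvd_sub (h1.mul_right _) (h2.mul_right _)
    set g : ℤ × ℤ → ℤ × ℤ := fun p =>
      ((p.1 * p₁.1 - D * p.2 * p₁.2) / N, (p.1 * p₁.2 - p₁.1 * p.2) / N) with hg
    have hg1 : ∀ p ∈ S, f p = f p₁ → N * (g p).1 = p.1 * p₁.1 - D * p.2 * p₁.2 :=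
      fun p hp hfp => Int.mul_ediv_cancel' (hdiv p hp hfp).1
    have hg2 : ∀ p ∈ S, f p = f p₁ → N * (g p).2 = p.1 * p₁.2 - p₁.1 * p.2 :=
      fun p hp hfp => Int.mul_ediv_cancel' (hdiv p hp hfp).2
    rw [← Finset.card_image_of_injOn (f := g)]
    · refine card_pell_le hD ?_ ?_
      · intro u hu
        obtain ⟨p, hp, rfl⟩ := Finset.mem_image.1 hu
        obtain ⟨hp, hfp⟩ := Finset.mem_filter.1 hp
        have h1 := hg1 p hp hfp
        have h2 := hg2 p hp hfp
        have h3 : N ^ 2 * ((g p).1 ^ 2 - D * (g p).2 ^ 2) = N ^ 2 * 1 := by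
          calc N ^ 2 * ((g p).1 ^ 2 - D * (g p).2 ^ 2)
              = (N * (g p).1) ^ 2 - D * (N * (g p).2) ^ 2 := by ring
            _ = (p.1 ^ 2 - D * p.2 ^ 2) * (p₁.1 ^ 2 - D * p₁.2 ^ 2) := by rw [h1, h2]; ring
            _ = N ^ 2 * 1 := by rw [hS p hp, hS p₁ hp₁]; ring
        exact mul_left_cancel₀ (pow_ne_zero 2 hN) h3
      · intro u hu
        obtain ⟨p, hp, rfl⟩ := Finset.mem_image.1 hu
        obtain ⟨hp, hfp⟩ := Finset.mem_filter.1 hp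
        have h1 := hg1 p hp hfp
        have h2 : |(g p).1| ≤ |p.1 * p₁.1 - D * p.2 * p₁.2| := by
          rw [← h1, abs_mul]
          exact le_mul_of_one_le_left (abs_nonneg _) (Int.one_le_abs hN)
        have h3 : |p.1 * p₁.1 - D * p.2 * p₁.2| ≤ U * U + |D| * U * U := by
          refine (abs_sub _ _).trans ?_
          rw [abs_mul, abs_mul, abs_mul]
          gcongr
          exacts [(hU p hp).1, (hU p₁ hp₁).1, (hU p hp).2, (hU p₁ hp₁).2]
        push_cast
        linarith
    · intro p hp p' hp' heq
      obtain ⟨hp, hfp⟩ := Finset.mem_filter.1 hp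
      obtain ⟨hp', hfp'⟩ := Finset.mem_filter.1 hp'
      have e1 : p.1 * p₁.1 - D * p.2 * p₁.2 = p'.1 * p₁.1 - D * p'.2 * p₁.2 := by
        rw [← hg1 p hp hfp, ← hg1 p' hp' hfp', heq]
      have e2 : p.1 * p₁.2 - p₁.1 * p.2 = p'.1 * p₁.2 - p₁.1 * p'.2 := by
        rw [← hg2 p hp hfp, ← hg2 p' hp' hfp', heq]
      have h1 := hS p₁ hp₁
      have e3 : N * p.1 = N * p'.1 := by
        rw [← h1]; linear_combination p₁.1 * e1 - D * p₁.2 * e2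
      have e4 : N * p.2 = N * p'.2 := by
        rw [← h1]; linear_combination p₁.2 * e1 - p₁.1 * e2
      exact Prod.ext (mul_left_cancel₀ hN e3) (mul_left_cancel₀ hN e4)
  calc (S.card : ℝ) ≤ (((4 * ((U ^ 2 * (1 + D.natAbs)).size + 1)) * (S.image f).card : ℕ) : ℝ) := by
        exact_mod_cast hfiber
    _ = ((S.image f).card : ℝ) * (4 * ((U ^ 2 * (1 + D.natAbs)).size + 1) : ℕ) := by
        rw [Nat.cast_mul, mul_comm]
    _ ≤ _ := by gcongr

/-- The number of representations of `N` by `x² - D y²` in a box. -/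
theorem card_norm_eq_le {S : Finset (ℤ × ℤ)} {D N : ℤ} {U : ℕ} {H : ℝ} (hD : D ≠ 0)
    (hN : N ≠ 0) (hS : ∀ p ∈ S, p.1 ^ 2 - D * p.2 ^ 2 = N)
    (hU : ∀ p ∈ S, |p.1| ≤ U ∧ |p.2| ≤ U)
    (hH : ∀ h : ℕ, ((h : ℤ) ^ 2) ∣ 4 * D → (h : ℝ) ≤ H) :
    (S.card : ℝ) ≤ (N.natAbs.divisors.card : ℝ) ^ 2 * (1 + 2 * H) *
      (4 * ((U ^ 2 * (1 + D.natAbs)).size + 1) : ℕ) := by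
  have hH1 : 1 ≤ H := by simpa using hH 1 (by simp)
  have hgdvd : ∀ p ∈ S, ((Int.gcd p.1 p.2 : ℕ) : ℤ) ^ 2 ∣ N := by
    intro p hp
    rw [← hS p hp]
    exact dvd_sub (pow_dvd_pow_of_dvd (Int.gcd_dvd_left ..) 2)
      ((pow_dvd_pow_of_dvd (Int.gcd_dvd_right ..) 2).mul_left _)
  rw [Finset.card_eq_sum_card_fiberwise (f := fun p : ℤ × ℤ => Int.gcd p.1 p.2)
    (t := N.natAbs.divisors)]
  swap
  · intro p hp
    simp only [Finset.mem_coe, Nat.mem_divisors]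
    refine ⟨?_, by simpa using hN⟩
    rw [← Int.natCast_dvd]
    exact (dvd_pow_self _ two_ne_zero).trans (hgdvd p hp)
  rw [Nat.cast_sum, sq, mul_assoc, mul_assoc, ← nsmul_eq_mul, ← mul_assoc]
  refine Finset.sum_le_card_nsmul _ _ _ fun d hd => ?_
  set F := {p ∈ S | Int.gcd p.1 p.2 = d} with hF
  rcases F.eq_empty_or_nonempty with hFe | ⟨p₀, hp₀⟩
  · rw [hFe]; simp only [Finset.card_empty, Nat.cast_zero]; positivity
  have hd0 : (d : ℤ) ≠ 0 := by
    have := Nat.pos_of_mem_divisors hd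
    exact_mod_cast this.ne'
  obtain ⟨n, hn⟩ : (d : ℤ) ^ 2 ∣ N := by
    obtain ⟨h1, h2⟩ := Finset.mem_filter.1 hp₀
    rw [← h2]; exact hgdvd p₀ h1
  have hn0 : n ≠ 0 := by rintro rfl; simp at hn; exact hN hn
  have hmul : ∀ p ∈ F, p.1 = d * (p.1 / d) ∧ p.2 = d * (p.2 / d) := by
    intro p hp
    obtain ⟨-, h2⟩ := Finset.mem_filter.1 hp
    exact ⟨(Int.mul_ediv_cancel' (h2 ▸ Int.gcd_dvd_left ..)).symm,
      (Int.mul_ediv_cancel' (h2 ▸ Int.gcd_dvd_right ..)).symm⟩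
  set g : ℤ × ℤ → ℤ × ℤ := fun p => (p.1 / d, p.2 / d) with hg
  have hinj : Set.InjOn g F := by
    intro p hp p' hp' heq
    simp only [hg, Prod.mk.injEq] at heq
    ext
    · rw [(hmul p hp).1, (hmul p' hp').1, heq.1]
    · rw [(hmul p hp).2, (hmul p' hp').2, heq.2]
  rw [← Finset.card_image_of_injOn hinj]
  have hle : ∀ z : ℤ, |z| ≤ U → |z / d| ≤ U := by
    intro z hz
    have := Int.abs_ediv_le_abs z d
    exact this.trans hz
  refine (card_primitive_norm_eq_le (N := n) (U := U) hD hn0 ?_ ?_ ?_ hH).trans ?_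
  · intro u hu
    obtain ⟨p, hp, rfl⟩ := Finset.mem_image.1 hu
    have h1 := hS p (Finset.mem_filter.1 hp).1
    rw [(hmul p hp).1, (hmul p hp).2, hn] at h1
    apply mul_left_cancel₀ (pow_ne_zero 2 hd0)
    simp only [hg]
    linear_combination h1
  · intro u hu
    obtain ⟨p, hp, rfl⟩ := Finset.mem_image.1 hu
    have h1 := hU p (Finset.mem_filter.1 hp).1
    exact ⟨hle _ h1.1, hle _ h1.2⟩
  · intro u hu
    obtain ⟨p, hp, rfl⟩ := Finset.mem_image.1 hu
    obtain ⟨-, h2⟩ := Finset.mem_filter.1 hp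
    rw [Int.isCoprime_iff_gcd_eq_one]
    simp only [hg]
    rw [← h2]
    exact Int.gcd_ediv_gcd_ediv_gcd (by omega)
  · gcongr
    · exact Int.natAbs_dvd_natAbs.2 ⟨(d : ℤ) ^ 2, by rw [hn]; ring⟩

/-- A bound for the partial sums of `∑ n ^ (-s)` over the multiples of `d`. -/
theorem exists_sum_multiples_rpow_le {s : ℝ} (hs : 1 < s) :
    ∃ Z : ℝ, 0 < Z ∧ ∀ d N : ℕ, 0 < d →
      ∑ n ∈ Finset.Icc 1 N with d ∣ n, (n : ℝ) ^ (-s) ≤ Z * (d : ℝ) ^ (-s) := by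
  have hsum : Summable (fun n : ℕ => (n : ℝ) ^ (-s)) := Real.summable_nat_rpow.2 (by linarith)
  refine ⟨∑' n : ℕ, (n : ℝ) ^ (-s), ?_, fun d N hd => ?_⟩
  · exact hsum.tsum_pos (fun n => by positivity) 1 (by simp)
  have hsub : {n ∈ Finset.Icc 1 N | d ∣ n} ⊆ (Finset.Icc 1 N).image (fun k => d * k) := by
    intro n hn
    obtain ⟨hn1, k, rfl⟩ := Finset.mem_filter.1 hn
    rw [Finset.mem_Icc] at hn1
    refine Finset.mem_image.2 ⟨k, Finset.mem_Icc.2 ⟨Nat.pos_of_mul_pos_left hn1.1, ?_⟩, rfl⟩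
    exact (Nat.le_mul_of_pos_left k hd).trans hn1.2
  calc ∑ n ∈ Finset.Icc 1 N with d ∣ n, (n : ℝ) ^ (-s)
      ≤ ∑ n ∈ (Finset.Icc 1 N).image (fun k => d * k), (n : ℝ) ^ (-s) :=
        Finset.sum_le_sum_of_subset_of_nonneg hsub (fun _ _ _ => by positivity)
    _ = ∑ k ∈ Finset.Icc 1 N, (d : ℝ) ^ (-s) * (k : ℝ) ^ (-s) := by
        rw [Finset.sum_image (fun x _ y _ h => Nat.eq_of_mul_eq_mul_left hd h)]
        refine Finset.sum_congr rfl fun k _ => ?_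
        push_cast
        rw [Real.mul_rpow (by positivity) (by positivity)]
    _ = (d : ℝ) ^ (-s) * ∑ k ∈ Finset.Icc 1 N, (k : ℝ) ^ (-s) := by rw [Finset.mul_sum]
    _ ≤ (d : ℝ) ^ (-s) * ∑' n : ℕ, (n : ℝ) ^ (-s) := by
        gcongr
        exact hsum.sum_le_tsum _ (fun _ _ => by positivity)
    _ = _ := mul_comm _ _

/-- The binary length grows slower than every power. -/
theorem exists_size_le_rpow {ε : ℝ} (hε : 0 < ε) :
    ∃ C : ℝ, 1 ≤ C ∧ ∀ V : ℕ, 0 < V → ((V.size + 1 : ℕ) : ℝ) ≤ C * (V : ℝ) ^ ε := by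
  obtain ⟨C, hC, h⟩ := exists_card_divisors_le_rpow hε
  refine ⟨2 * C, by linarith, fun V hV => ?_⟩
  obtain ⟨k, hk⟩ : ∃ k, V.size = k + 1 :=
    ⟨_, (Nat.succ_pred_eq_of_pos (Nat.size_pos.2 hV)).symm⟩
  have h1 : 2 ^ k ≤ V := Nat.lt_size.1 (by omega)
  have h2 := h (2 ^ k) (by positivity)
  rw [Nat.divisors_prime_pow Nat.prime_two, Finset.card_map, Finset.card_range] at h2
  have h3 : ((2 ^ k : ℕ) : ℝ) ^ ε ≤ (V : ℝ) ^ ε := by gcongr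
  rw [hk]
  push_cast at h2 h3 ⊢
  nlinarith

/-- The nonzero integers of absolute value at most `R`. -/
noncomputable def nonzeroIntegers (R : ℝ) : Finset ℤ :=
  (Finset.Icc (-(⌊R⌋₊ : ℤ)) ⌊R⌋₊).erase 0

theorem mem_nonzeroIntegers {R : ℝ} (hR : 0 ≤ R) {z : ℤ} :
    z ∈ nonzeroIntegers R ↔ z ≠ 0 ∧ |(z : ℝ)| ≤ R := by
  have h : |(z : ℝ)| ≤ R ↔ z.natAbs ≤ ⌊R⌋₊ := by
    rw [Nat.le_floor_iff hR, Nat.cast_natAbs, Int.cast_abs]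
  rw [h, nonzeroIntegers, Finset.mem_erase, Finset.mem_Icc]
  omega

theorem card_nonzeroIntegers_le {R : ℝ} (hR : 0 ≤ R) :
    ((nonzeroIntegers R).card : ℝ) ≤ 2 * R := by
  have := card_nonzero_multiples_le (S := nonzeroIntegers R) one_pos hR
    (fun x hx => ⟨((mem_nonzeroIntegers hR).1 hx).1, by simp, ((mem_nonzeroIntegers hR).1 hx).2⟩)
  simpa using this

/-- The number of nonzero `|z| ≤ R` with `d ∣ k z`. -/
theorem card_nonzeroIntegers_filter_le {R : ℝ} (hR : 0 ≤ R) {d k : ℕ} (hd : 0 < d) (hk : 0 < k) :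
    (({z ∈ nonzeroIntegers R | (d : ℤ) ∣ k * z}.card : ℕ) : ℝ) ≤ 2 * (k * R) / d := by
  have hk' : (k : ℤ) ≠ 0 := by exact_mod_cast hk.ne'
  rw [← Finset.card_image_of_injective _ (mul_right_injective₀ hk')]
  refine card_nonzero_multiples_le hd (by positivity) fun x hx => ?_
  obtain ⟨z, hz, rfl⟩ := Finset.mem_image.1 hx
  obtain ⟨hz1, hz2⟩ := Finset.mem_filter.1 hz
  rw [mem_nonzeroIntegers hR] at hz1
  refine ⟨mul_ne_zero hk' hz1.1, hz2, ?_⟩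
  push_cast
  rw [abs_mul, Nat.abs_cast]
  gcongr
  exact hz1.2

/-- A sum over factorizations which majorizes every `h₀ ∣ ℓ` with `h₀² ∣ 432 A³`. -/
noncomputable def squareGcdMajorant (L : ℕ) (A : ℤ) (ℓ : ℕ) : ℝ :=
  ∑ e ∈ Finset.Icc 1 L, ∑ h ∈ Finset.Icc 1 L,
    if e * h ∣ ℓ ∧ (e : ℤ) ∣ A ∧ h ^ 2 ∣ 432 * e then (e : ℝ) * h else 0

theorem squareGcdMajorant_nonneg (L : ℕ) (A : ℤ) (ℓ : ℕ) : 0 ≤ squareGcdMajorant L A ℓ :=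
  Finset.sum_nonneg fun _ _ => Finset.sum_nonneg fun _ _ => by split_ifs <;> positivity

theorem le_squareGcdMajorant {L ℓ h₀ : ℕ} {A : ℤ} (hℓ : 0 < ℓ) (hℓL : ℓ ≤ L) (hdvd : h₀ ∣ ℓ)
    (hsq : (h₀ : ℤ) ^ 2 ∣ 432 * A ^ 3) : (h₀ : ℝ) ≤ squareGcdMajorant L A ℓ := by
  have hh₀ : 0 < h₀ := Nat.pos_of_dvd_of_pos hdvd hℓ
  have he0 : 0 < Nat.gcd h₀ A.natAbs := Nat.gcd_pos_of_pos_left _ hh₀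
  obtain ⟨h, a, hcop, hh, ha⟩ := Nat.exists_coprime h₀ A.natAbs
  set e := Nat.gcd h₀ A.natAbs with he
  have h1 : h₀ = e * h := by rw [mul_comm]; exact hh
  have h0 : 0 < h := Nat.pos_of_ne_zero (by rintro rfl; simp at h1; omega)
  have h2 : h ^ 2 ∣ 432 * e := by
    have h3 : h₀ ^ 2 ∣ 432 * A.natAbs ^ 3 := by
      have := Int.natAbs_dvd_natAbs.2 hsq
      simpa [Int.natAbs_mul, Int.natAbs_pow] using this
    rw [h1, ha] at h3
    have h4 : e ^ 2 * h ^ 2 ∣ e ^ 2 * (432 * e * a ^ 3) := by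
      convert h3 using 1 <;> ring
    have h5 := Nat.dvd_of_mul_dvd_mul_left (by positivity) h4
    exact (Nat.Coprime.pow 2 3 hcop).dvd_of_dvd_mul_right h5
  have heL : e ∈ Finset.Icc 1 L := Finset.mem_Icc.2 ⟨he0,
    (Nat.le_of_dvd hℓ ((Dvd.intro _ h1.symm).trans hdvd)).trans hℓL⟩
  have hhL : h ∈ Finset.Icc 1 L := Finset.mem_Icc.2 ⟨h0,
    (Nat.le_of_dvd hℓ ((Dvd.intro_left _ h1.symm).trans hdvd)).trans hℓL⟩
  have hcond : e * h ∣ ℓ ∧ (e : ℤ) ∣ A ∧ h ^ 2 ∣ 432 * e :=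
    ⟨h1 ▸ hdvd, Int.natCast_dvd.2 (Nat.gcd_dvd_right _ _), h2⟩
  calc (h₀ : ℝ) = if e * h ∣ ℓ ∧ (e : ℤ) ∣ A ∧ h ^ 2 ∣ 432 * e then (e : ℝ) * h else 0 := by
        rw [if_pos hcond, h1]; push_cast; rfl
    _ ≤ ∑ h ∈ Finset.Icc 1 L,
          if e * h ∣ ℓ ∧ (e : ℤ) ∣ A ∧ h ^ 2 ∣ 432 * e then (e : ℝ) * h else 0 :=
        Finset.single_le_sum (f := fun h : ℕ =>
          if e * h ∣ ℓ ∧ (e : ℤ) ∣ A ∧ h ^ 2 ∣ 432 * e then (e : ℝ) * h else 0)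
          (fun _ _ => by split_ifs <;> positivity) hhL
    _ ≤ squareGcdMajorant L A ℓ :=
        Finset.single_le_sum (f := fun e : ℕ => ∑ h ∈ Finset.Icc 1 L,
          if e * h ∣ ℓ ∧ (e : ℤ) ∣ A ∧ h ^ 2 ∣ 432 * e then (e : ℝ) * h else 0)
          (fun _ _ => Finset.sum_nonneg fun _ _ => by split_ifs <;> positivity) heL

/-- On average over `A` and `ℓ`, the majorant is small. -/
theorem exists_sum_squareGcdMajorant_le :
    ∃ K : ℝ, 0 < K ∧ ∀ (R : ℝ) (L : ℕ), 0 ≤ R →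
      ∑ ℓ ∈ Finset.Icc 1 L, (ℓ : ℝ) ^ (-(13 / 12) : ℝ) *
        ∑ A ∈ nonzeroIntegers R, squareGcdMajorant L A ℓ ≤ K * R := by
  obtain ⟨Z, hZ, hsum⟩ := exists_sum_multiples_rpow_le (s := 13 / 12) (by norm_num)
  obtain ⟨Z', hZ', hsum'⟩ := exists_sum_multiples_rpow_le (s := 9 / 4) (by norm_num)
  refine ⟨2 * Z * ((432 : ℝ) ^ (13 / 12 : ℝ) * Z) * Z', by positivity, fun R L hR => ?_⟩
  have hA : ∀ ℓ : ℕ, ∑ A ∈ nonzeroIntegers R, squareGcdMajorant L A ℓ ≤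
      ∑ e ∈ Finset.Icc 1 L, ∑ h ∈ Finset.Icc 1 L,
        if e * h ∣ ℓ ∧ h ^ 2 ∣ 432 * e then 2 * R * h else 0 := by
    intro ℓ
    simp only [squareGcdMajorant]
    rw [Finset.sum_comm]
    refine Finset.sum_le_sum fun e he => ?_
    have he0 : 0 < e := (Finset.mem_Icc.1 he).1
    rw [Finset.sum_comm]
    refine Finset.sum_le_sum fun h _ => ?_
    by_cases hc : e * h ∣ ℓ ∧ h ^ 2 ∣ 432 * e
    · rw [if_pos hc]
      have : ∀ A : ℤ, (if e * h ∣ ℓ ∧ (e : ℤ) ∣ A ∧ h ^ 2 ∣ 432 * e then (e : ℝ) * h else 0) =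
          if (e : ℤ) ∣ (1 : ℕ) * A then (e : ℝ) * h else 0 := by
        intro A; simp [hc.1, hc.2]
      simp only [this]
      rw [← Finset.sum_filter, Finset.sum_const, nsmul_eq_mul]
      have h1 := card_nonzeroIntegers_filter_le hR he0 one_pos
      have he' : (0 : ℝ) < e := by exact_mod_cast he0
      calc _ ≤ 2 * (((1 : ℕ) : ℝ) * R) / e * ((e : ℝ) * h) := by gcongr
        _ = 2 * R * h := by push_cast; field_simp
    · rw [if_neg hc]
      refine (Finset.sum_eq_zero fun A _ => if_neg fun h' => hc ⟨h'.1, h'.2.2⟩).le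
  have hℓ : ∀ e h : ℕ, 0 < e → 0 < h → ∑ ℓ ∈ Finset.Icc 1 L, (ℓ : ℝ) ^ (-(13 / 12) : ℝ) *
      (if e * h ∣ ℓ ∧ h ^ 2 ∣ 432 * e then 2 * R * h else 0) ≤
      if h ^ 2 ∣ 432 * e then
        2 * R * Z * ((h : ℝ) * (h : ℝ) ^ (-(13 / 12) : ℝ)) * (e : ℝ) ^ (-(13 / 12) : ℝ) else 0 := by
    intro e h he hh
    by_cases hc : h ^ 2 ∣ 432 * e
    · simp only [hc, and_true, if_true, mul_ite, mul_zero]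
      rw [← Finset.sum_filter, ← Finset.sum_mul]
      have h1 := hsum (e * h) L (by positivity)
      push_cast at h1
      rw [Real.mul_rpow (by positivity) (by positivity)] at h1
      calc _ ≤ (Z * ((e : ℝ) ^ (-(13 / 12) : ℝ) * (h : ℝ) ^ (-(13 / 12) : ℝ))) * (2 * R * h) := by
            gcongr
        _ = _ := by ring
    · simp [hc]
  have he : ∀ h : ℕ, 0 < h → ∑ e ∈ Finset.Icc 1 L with h ^ 2 ∣ 432 * e,
      (e : ℝ) ^ (-(13 / 12) : ℝ) ≤
      (432 : ℝ) ^ (13 / 12 : ℝ) * (Z * ((h : ℝ) ^ 2) ^ (-(13 / 12) : ℝ)) := by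
    intro h hh
    have h1 := hsum (h ^ 2) (432 * L) (by positivity)
    push_cast at h1
    calc ∑ e ∈ Finset.Icc 1 L with h ^ 2 ∣ 432 * e, (e : ℝ) ^ (-(13 / 12) : ℝ)
        = (432 : ℝ) ^ (13 / 12 : ℝ) * ∑ e ∈ Finset.Icc 1 L with h ^ 2 ∣ 432 * e,
          ((432 * e : ℕ) : ℝ) ^ (-(13 / 12) : ℝ) := by
          rw [Finset.mul_sum]
          refine Finset.sum_congr rfl fun e _ => ?_
          push_cast
          rw [Real.mul_rpow (by positivity) (by positivity), ← mul_assoc,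
            ← Real.rpow_add (by positivity)]
          norm_num
      _ = (432 : ℝ) ^ (13 / 12 : ℝ) *
          ∑ n ∈ {e ∈ Finset.Icc 1 L | h ^ 2 ∣ 432 * e}.image (fun e : ℕ => 432 * e),
          ((n : ℕ) : ℝ) ^ (-(13 / 12) : ℝ) := by
          rw [Finset.sum_image (fun x _ y _ h => Nat.eq_of_mul_eq_mul_left (by norm_num) h)]
      _ ≤ (432 : ℝ) ^ (13 / 12 : ℝ) *
          ∑ n ∈ Finset.Icc 1 (432 * L) with h ^ 2 ∣ n, (n : ℝ) ^ (-(13 / 12) : ℝ) := by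
          gcongr
          intro n hn
          obtain ⟨e, he, rfl⟩ := Finset.mem_image.1 hn
          simp only [Finset.mem_filter, Finset.mem_Icc] at he ⊢
          exact ⟨by omega, he.2⟩
      _ ≤ _ := by gcongr
  have hexp : ∀ h : ℕ, 0 < h → (h : ℝ) * (h : ℝ) ^ (-(13 / 12) : ℝ) *
      ((h : ℝ) ^ 2) ^ (-(13 / 12) : ℝ) = (h : ℝ) ^ (-(9 / 4) : ℝ) := by
    intro h hh
    have hh' : (0 : ℝ) < h := by exact_mod_cast hh
    rw [← Real.rpow_natCast, ← Real.rpow_mul hh'.le]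
    nth_rewrite 1 [← Real.rpow_one (h : ℝ)]
    rw [← Real.rpow_add hh', ← Real.rpow_add hh']
    norm_num
  calc ∑ ℓ ∈ Finset.Icc 1 L, (ℓ : ℝ) ^ (-(13 / 12) : ℝ) *
        ∑ A ∈ nonzeroIntegers R, squareGcdMajorant L A ℓ
      ≤ ∑ ℓ ∈ Finset.Icc 1 L, (ℓ : ℝ) ^ (-(13 / 12) : ℝ) *
        ∑ e ∈ Finset.Icc 1 L, ∑ h ∈ Finset.Icc 1 L,
        if e * h ∣ ℓ ∧ h ^ 2 ∣ 432 * e then 2 * R * h else 0 := by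
        gcongr with ℓ _
        exact hA ℓ
    _ = ∑ h ∈ Finset.Icc 1 L, ∑ e ∈ Finset.Icc 1 L, ∑ ℓ ∈ Finset.Icc 1 L,
        (ℓ : ℝ) ^ (-(13 / 12) : ℝ) *
          (if e * h ∣ ℓ ∧ h ^ 2 ∣ 432 * e then 2 * R * h else 0) := by
        simp only [Finset.mul_sum]
        rw [Finset.sum_comm, Finset.sum_congr rfl (fun e _ => Finset.sum_comm), Finset.sum_comm]
    _ ≤ ∑ h ∈ Finset.Icc 1 L, ∑ e ∈ Finset.Icc 1 L, if h ^ 2 ∣ 432 * e then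
        2 * R * Z * ((h : ℝ) * (h : ℝ) ^ (-(13 / 12) : ℝ)) * (e : ℝ) ^ (-(13 / 12) : ℝ) else 0 :=
        Finset.sum_le_sum fun h hh => Finset.sum_le_sum fun e he =>
          hℓ e h (Finset.mem_Icc.1 he).1 (Finset.mem_Icc.1 hh).1
    _ ≤ ∑ h ∈ Finset.Icc 1 L, 2 * R * Z * ((432 : ℝ) ^ (13 / 12 : ℝ) * Z) *
          (h : ℝ) ^ (-(9 / 4) : ℝ) := by
        refine Finset.sum_le_sum fun h hh => ?_
        have hh0 := (Finset.mem_Icc.1 hh).1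
        rw [← Finset.sum_filter, ← Finset.mul_sum, ← hexp h hh0]
        calc _ ≤ 2 * R * Z * ((h : ℝ) * (h : ℝ) ^ (-(13 / 12) : ℝ)) *
              ((432 : ℝ) ^ (13 / 12 : ℝ) * (Z * ((h : ℝ) ^ 2) ^ (-(13 / 12) : ℝ))) := by
              gcongr
              exact he h hh0
          _ = _ := by ring
    _ ≤ 2 * R * Z * ((432 : ℝ) ^ (13 / 12 : ℝ) * Z) * Z' := by
        rw [← Finset.mul_sum]
        have := hsum' 1 L one_pos
        simp only [one_dvd, Finset.filter_true, Nat.cast_one, Real.one_rpow,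
          mul_one] at this
        gcongr
    _ = _ := by ring

/-- A sum which majorizes every `h` with `h² ∣ 108 m`. -/
noncomputable def squareDivisorMajorant (Q : ℕ) (m : ℤ) : ℝ :=
  ∑ h ∈ Finset.Icc 1 Q with ((h ^ 2 : ℕ) : ℤ) ∣ (108 : ℕ) * m, (h : ℝ)

theorem squareDivisorMajorant_nonneg (Q : ℕ) (m : ℤ) : 0 ≤ squareDivisorMajorant Q m :=
  Finset.sum_nonneg fun _ _ => by positivity

theorem le_squareDivisorMajorant {Q h : ℕ} {m : ℤ} (hm : m ≠ 0) (hQ : 108 * m.natAbs ≤ Q)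
    (hh : (h : ℤ) ^ 2 ∣ 108 * m) : (h : ℝ) ≤ squareDivisorMajorant Q m := by
  have h1 : h ^ 2 ∣ 108 * m.natAbs := by
    have := Int.natAbs_dvd_natAbs.2 hh
    simpa [Int.natAbs_mul, Int.natAbs_pow] using this
  have h2 : h ^ 2 ≤ 108 * m.natAbs := Nat.le_of_dvd (by omega) h1
  have h3 : h ≠ 0 := by
    rintro rfl
    simp [hm] at h1
  have h4 : h ≤ h ^ 2 := Nat.le_self_pow two_ne_zero h
  refine Finset.single_le_sum (f := fun h : ℕ => (h : ℝ)) (fun _ _ => by positivity)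
    (Finset.mem_filter.2 ⟨Finset.mem_Icc.2 ⟨by omega, by omega⟩, by exact_mod_cast hh⟩)

theorem exists_sum_squareDivisorMajorant_le {ε : ℝ} (hε : 0 < ε) :
    ∃ K : ℝ, 0 < K ∧ ∀ (R : ℝ) (Q : ℕ), 0 ≤ R →
      ∑ m ∈ nonzeroIntegers R, squareDivisorMajorant Q m ≤ K * R * (Q : ℝ) ^ ε := by
  obtain ⟨Z, hZ, hsum⟩ := exists_sum_multiples_rpow_le (s := 1 + ε) (by linarith)
  refine ⟨216 * Z, by positivity, fun R Q hR => ?_⟩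
  calc ∑ m ∈ nonzeroIntegers R, squareDivisorMajorant Q m
      = ∑ h ∈ Finset.Icc 1 Q,
          ({m ∈ nonzeroIntegers R | ((h ^ 2 : ℕ) : ℤ) ∣ (108 : ℕ) * m}.card : ℝ) * h := by
        simp only [squareDivisorMajorant, Finset.sum_filter]
        rw [Finset.sum_comm]
        refine Finset.sum_congr rfl fun h _ => ?_
        rw [← Finset.sum_filter, Finset.sum_const, nsmul_eq_mul]
    _ ≤ ∑ h ∈ Finset.Icc 1 Q, 216 * R * (Q : ℝ) ^ ε * (h : ℝ) ^ (-(1 + ε)) := by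
        refine Finset.sum_le_sum fun h hh => ?_
        obtain ⟨h1, h2⟩ := Finset.mem_Icc.1 hh
        have h1' : (0 : ℝ) < h := by exact_mod_cast h1
        have h3 := card_nonzeroIntegers_filter_le hR (d := h ^ 2) (k := 108) (by positivity)
          (by norm_num)
        have h4 : (h : ℝ)⁻¹ ≤ (Q : ℝ) ^ ε * (h : ℝ) ^ (-(1 + ε)) := by
          rw [neg_add, Real.rpow_add h1', Real.rpow_neg_one, mul_left_comm]
          refine le_mul_of_one_le_right (by positivity) ?_
          rw [Real.rpow_neg h1'.le, ← div_eq_mul_inv, one_le_div (by positivity)]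
          gcongr
        calc _ ≤ 2 * (((108 : ℕ) : ℝ) * R) / ((h ^ 2 : ℕ) : ℝ) * h := by gcongr
          _ = 216 * R * (h : ℝ)⁻¹ := by push_cast; field_simp; ring
          _ ≤ 216 * R * ((Q : ℝ) ^ ε * (h : ℝ) ^ (-(1 + ε))) := by gcongr
          _ = _ := by ring
    _ ≤ 216 * R * (Q : ℝ) ^ ε * Z := by
        rw [← Finset.mul_sum]
        have := hsum 1 Q one_pos
        simp only [one_dvd, Finset.filter_true, Nat.cast_one, Real.one_rpow,
          mul_one] at this
        gcongr
    _ = _ := by ring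

theorem Eset_abs_fst_le {δ X : ℝ} {t : ℤ × ℤ × ℤ × ℤ} (ht : t ∈ Eset δ X) (hX : 1 ≤ X) :
    |(t.1 : ℝ)| ≤ X ^ (1 / 3 : ℝ) := by
  have h : |(t.1 : ℝ)| ^ 3 ≤ X := by
    simpa only [Int.cast_abs] using ht.2.2.2.2.1
  refine le_of_pow_le_pow_left₀ three_ne_zero (by positivity) (h.trans_eq ?_)
  rw [← Real.rpow_natCast, ← Real.rpow_mul (by linarith)]
  norm_num

theorem Eset_abs_snd_le {δ X : ℝ} {t : ℤ × ℤ × ℤ × ℤ} (ht : t ∈ Eset δ X) (hX : 1 ≤ X) :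
    |(t.2.1 : ℝ)| ≤ X ^ (1 / 2 : ℝ) := by
  have h : (t.2.1 : ℝ) ^ 2 ≤ X := ht.2.2.2.2.2.1
  refine le_of_pow_le_pow_left₀ two_ne_zero (by positivity) ?_
  rw [sq_abs]
  refine h.trans_eq ?_
  rw [← Real.rpow_natCast, ← Real.rpow_mul (by linarith)]
  norm_num

/-- The number of `B` for which `(A, B, m, ℓ)` lies in `Eset δ X`, for given `A` and `ℓ`. -/
theorem card_fiber_fst_ell_le {δ X : ℝ} (hX : 1 ≤ X) {F : Finset (ℤ × ℤ × ℤ × ℤ)} {A : ℤ}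
    {ℓ L : ℕ} (hF : ∀ t ∈ F, t ∈ Eset δ X ∧ t.1 = A ∧ t.2.2.2 = ℓ) (hℓ : 0 < ℓ) (hL : ℓ ≤ L) :
    (F.card : ℝ) ≤ (ℓ ^ 2).divisors.card *
      (1 + 54 * X ^ (1 / 2 : ℝ) * squareGcdMajorant L A ℓ / (ℓ : ℝ) ^ 2) := by
  have hinj : Set.InjOn (fun t : ℤ × ℤ × ℤ × ℤ => 27 * t.2.1) F := by
    intro t ht t' ht' heq
    obtain ⟨h1, h2, h3⟩ := hF t ht
    obtain ⟨h1', h2', h3'⟩ := hF t' ht'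
    have hB : t.2.1 = t'.2.1 := by simp only at heq; omega
    have hm : t.2.2.1 = t'.2.2.1 := by
      have e := h1.2.2.2.2.2.2.2
      have e' := h1'.2.2.2.2.2.2.2
      rw [h2, hB, h3] at e
      rw [h2', h3', e] at e'
      exact mul_right_cancel₀ (by positivity) e'
    ext
    · rw [h2, h2']
    · exact hB
    · exact hm
    · rw [h3, h3']
  have hG := squareGcdMajorant_nonneg L A ℓ
  rw [← Finset.card_image_of_injOn hinj]
  refine (card_sqrt_mod_le (q := ℓ ^ 2) (Z := 27 * ⌊X ^ (1 / 2 : ℝ)⌋₊) (c := -(108 * A ^ 3))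
    (H := squareGcdMajorant L A ℓ) (by positivity) ?_ ?_ ?_).trans ?_
  · intro x hx
    obtain ⟨t, ht, rfl⟩ := Finset.mem_image.1 hx
    have h1 := Eset_abs_snd_le (hF t ht).1 hX
    have h2 : t.2.1.natAbs ≤ ⌊X ^ (1 / 2 : ℝ)⌋₊ := by
      apply Nat.le_floor
      rwa [Nat.cast_natAbs, Int.cast_abs]
    rw [Int.abs_eq_natAbs, Int.natAbs_mul]
    exact_mod_cast Nat.mul_le_mul_left 27 h2
  · intro x hx
    obtain ⟨t, ht, rfl⟩ := Finset.mem_image.1 hx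
    obtain ⟨h1, h2, h3⟩ := hF t ht
    have e := h1.2.2.2.2.2.2.2
    rw [h2, h3] at e
    refine ⟨27 * t.2.2.1, ?_⟩
    push_cast
    linear_combination 27 * e
  · intro h hh hh'
    refine le_squareGcdMajorant hℓ hL ((Nat.pow_dvd_pow_iff two_ne_zero).1 hh) ?_
    have : 432 * A ^ 3 = -(4 * -(108 * A ^ 3)) := by ring
    rw [this]
    exact hh'.neg_right
  · have h1 : (⌊X ^ (1 / 2 : ℝ)⌋₊ : ℝ) ≤ X ^ (1 / 2 : ℝ) := Nat.floor_le (by positivity)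
    push_cast
    rw [show (2 : ℝ) * (27 * (⌊X ^ (1 / 2 : ℝ)⌋₊ : ℝ)) = 54 * (⌊X ^ (1 / 2 : ℝ)⌋₊ : ℝ) by ring]
    gcongr

theorem exists_card_small_ell_le {δ : ℝ} (hδ : δ ∈ Set.Ioo (0 : ℝ) (1 / 6)) :
    ∃ C : ℝ, 0 < C ∧ ∀ X : ℝ, 1 ≤ X → ∀ T : Finset (ℤ × ℤ × ℤ × ℤ),
      (∀ t ∈ T, t ∈ Eset δ X ∧ (t.2.2.2 : ℝ) ≤ X ^ (1 / 3 : ℝ)) →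
      (T.card : ℝ) ≤ C * X ^ (5 / 6 - 5 * δ / 6) := by
  obtain ⟨C, hC, hdiv⟩ := exists_card_divisors_le_rpow (ε := 1 / 24) (by norm_num)
  obtain ⟨K, hK, hsum⟩ := exists_sum_squareGcdMajorant_le
  refine ⟨C * (2 + 54 * K), by positivity, fun X hX T hT => ?_⟩
  have hX0 : 0 < X := by linarith
  set R := X ^ (1 / 3 : ℝ) with hR
  have hR0 : 0 < R := by positivity
  set L := ⌊R⌋₊ with hL
  have hLR : (L : ℝ) ≤ R := Nat.floor_le hR0.le
  set 𝓛 : Finset ℕ := (Finset.Icc 1 L).filter (fun ℓ : ℕ => X ^ δ < (ℓ : ℝ)) with h𝓛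
  rw [Finset.card_eq_sum_card_fiberwise (f := fun t => (t.1, t.2.2.2.natAbs))
    (t := nonzeroIntegers R ×ˢ 𝓛)]
  swap
  · intro t ht
    obtain ⟨h1, h2⟩ := hT t ht
    have h3 : ((t.2.2.2.natAbs : ℕ) : ℝ) = t.2.2.2 := by
      rw [Nat.cast_natAbs, abs_of_nonneg (by linarith [h1.2.2.2.1])]
    have h4 := h1.2.2.2.1
    simp only [Finset.coe_product, Set.mem_prod, Finset.mem_coe, mem_nonzeroIntegers hR0.le, h𝓛,
      Finset.mem_filter, Finset.mem_Icc]
    refine ⟨⟨h1.1, Eset_abs_fst_le h1 hX⟩, ⟨by omega, ?_⟩, ?_⟩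
    · apply Nat.le_floor
      rwa [h3]
    · rw [h3]; exact h1.2.2.2.2.2.2.1
  have hterm : ∀ A ∈ nonzeroIntegers R, ∀ ℓ ∈ 𝓛,
      (({t ∈ T | (t.1, t.2.2.2.natAbs) = (A, ℓ)}.card : ℕ) : ℝ) ≤
      C * R ^ (1 / 12 : ℝ) + C * (54 * X ^ (1 / 2 : ℝ) * X ^ (-(5 * δ / 6))) *
        ((ℓ : ℝ) ^ (-(13 / 12) : ℝ) * squareGcdMajorant L A ℓ) := by
    intro A _ ℓ hℓ
    obtain ⟨hℓ1, hℓ2⟩ := Finset.mem_filter.1 hℓ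
    obtain ⟨hℓ0, hℓL⟩ := Finset.mem_Icc.1 hℓ1
    have hℓ' : (0 : ℝ) < ℓ := by exact_mod_cast hℓ0
    have hG := squareGcdMajorant_nonneg L A ℓ
    have h1 := card_fiber_fst_ell_le hX (F := {t ∈ T | (t.1, t.2.2.2.natAbs) = (A, ℓ)})
      (A := A) (ℓ := ℓ) (L := L) (δ := δ) (fun t ht => by
        obtain ⟨ht1, ht2⟩ := Finset.mem_filter.1 ht
        have h4 := (hT t ht1).1.2.2.2.1
        simp only [Prod.mk.injEq] at ht2
        exact ⟨(hT t ht1).1, ht2.1, by omega⟩) hℓ0 hℓL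
    have h2 := hdiv (ℓ ^ 2) (by positivity)
    have h3 : (((ℓ ^ 2 : ℕ) : ℝ)) ^ (1 / 24 : ℝ) = (ℓ : ℝ) ^ (1 / 12 : ℝ) := by
      push_cast
      rw [← Real.rpow_natCast, ← Real.rpow_mul hℓ'.le]
      norm_num
    rw [h3] at h2
    have h5 : (ℓ : ℝ) ^ (1 / 12 : ℝ) / (ℓ : ℝ) ^ 2 ≤
        X ^ (-(5 * δ / 6)) * (ℓ : ℝ) ^ (-(13 / 12) : ℝ) := by
      have e1 : (ℓ : ℝ) ^ (1 / 12 : ℝ) / (ℓ : ℝ) ^ 2 =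
          (ℓ : ℝ) ^ (-(5 / 6) : ℝ) * (ℓ : ℝ) ^ (-(13 / 12) : ℝ) := by
        rw [← Real.rpow_natCast, ← Real.rpow_sub hℓ', ← Real.rpow_add hℓ']
        norm_num
      have e2 : X ^ (-(5 * δ / 6)) = (X ^ δ) ^ (-(5 / 6) : ℝ) := by
        rw [← Real.rpow_mul hX0.le]; ring_nf
      rw [e1, e2]
      gcongr ?_ * _
      exact Real.rpow_le_rpow_of_nonpos (by positivity) hℓ2.le (by norm_num)
    calc _ ≤ _ := h1
      _ ≤ C * (ℓ : ℝ) ^ (1 / 12 : ℝ) *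
          (1 + 54 * X ^ (1 / 2 : ℝ) * squareGcdMajorant L A ℓ / (ℓ : ℝ) ^ 2) := by gcongr
      _ = C * (ℓ : ℝ) ^ (1 / 12 : ℝ) + C * (54 * X ^ (1 / 2 : ℝ) * squareGcdMajorant L A ℓ) *
          ((ℓ : ℝ) ^ (1 / 12 : ℝ) / (ℓ : ℝ) ^ 2) := by ring
      _ ≤ C * R ^ (1 / 12 : ℝ) + C * (54 * X ^ (1 / 2 : ℝ) * squareGcdMajorant L A ℓ) *
          (X ^ (-(5 * δ / 6)) * (ℓ : ℝ) ^ (-(13 / 12) : ℝ)) := by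
          have : (ℓ : ℝ) ≤ R := le_trans (by exact_mod_cast hℓL) hLR
          gcongr
      _ = _ := by ring
  have hcard : ((nonzeroIntegers R ×ˢ 𝓛).card : ℝ) ≤ 2 * R * R := by
    rw [Finset.card_product]
    push_cast
    have h1 : (𝓛.card : ℝ) ≤ L := by
      have := Finset.card_filter_le (Finset.Icc 1 L) (fun ℓ : ℕ => X ^ δ < (ℓ : ℝ))
      rw [Nat.card_Icc, Nat.add_sub_cancel] at this
      exact_mod_cast this
    gcongr
    · exact card_nonzeroIntegers_le hR0.le
    · exact h1.trans hLR
  rw [Nat.cast_sum]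
  have hRpow : R * R * R ^ (1 / 12 : ℝ) = X ^ (25 / 36 : ℝ) := by
    rw [hR, ← Real.rpow_mul hX0.le, ← Real.rpow_add hX0, ← Real.rpow_add hX0]
    norm_num
  have hXpow : X ^ (1 / 2 : ℝ) * X ^ (-(5 * δ / 6)) * R = X ^ (5 / 6 - 5 * δ / 6) := by
    rw [hR, ← Real.rpow_add hX0, ← Real.rpow_add hX0]
    ring_nf
  have hle : X ^ (25 / 36 : ℝ) ≤ X ^ (5 / 6 - 5 * δ / 6) :=
    Real.rpow_le_rpow_of_exponent_le hX (by linarith [hδ.2])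
  have hmain : ∑ p ∈ nonzeroIntegers R ×ˢ 𝓛,
      ((p.2 : ℝ) ^ (-(13 / 12) : ℝ) * squareGcdMajorant L p.1 p.2) ≤ K * R := by
    refine le_trans ?_ (hsum R L hR0.le)
    rw [Finset.sum_product_right]
    simp only [← Finset.mul_sum]
    refine Finset.sum_le_sum_of_subset_of_nonneg (Finset.filter_subset _ _) fun ℓ _ _ => ?_
    exact mul_nonneg (by positivity)
      (Finset.sum_nonneg fun A _ => squareGcdMajorant_nonneg L A ℓ)
  calc _ ≤ ∑ p ∈ nonzeroIntegers R ×ˢ 𝓛, (C * R ^ (1 / 12 : ℝ) +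
        C * (54 * X ^ (1 / 2 : ℝ) * X ^ (-(5 * δ / 6))) *
        ((p.2 : ℝ) ^ (-(13 / 12) : ℝ) * squareGcdMajorant L p.1 p.2)) :=
        Finset.sum_le_sum fun p hp =>
          hterm p.1 (Finset.mem_product.1 hp).1 p.2 (Finset.mem_product.1 hp).2
    _ = ((nonzeroIntegers R ×ˢ 𝓛).card : ℝ) * (C * R ^ (1 / 12 : ℝ)) +
        C * (54 * X ^ (1 / 2 : ℝ) * X ^ (-(5 * δ / 6))) * ∑ p ∈ nonzeroIntegers R ×ˢ 𝓛,
        ((p.2 : ℝ) ^ (-(13 / 12) : ℝ) * squareGcdMajorant L p.1 p.2) := by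
        rw [Finset.sum_add_distrib, Finset.sum_const, nsmul_eq_mul, ← Finset.mul_sum]
    _ ≤ 2 * R * R * (C * R ^ (1 / 12 : ℝ)) +
        C * (54 * X ^ (1 / 2 : ℝ) * X ^ (-(5 * δ / 6))) * (K * R) := by gcongr
    _ = 2 * C * (R * R * R ^ (1 / 12 : ℝ)) +
        54 * C * K * (X ^ (1 / 2 : ℝ) * X ^ (-(5 * δ / 6)) * R) := by ring
    _ ≤ 2 * C * X ^ (5 / 6 - 5 * δ / 6) + 54 * C * K * X ^ (5 / 6 - 5 * δ / 6) := by
        rw [hRpow, hXpow]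
        gcongr
    _ = _ := by ring

theorem Eset_abs_mul_sq_le {δ X : ℝ} {t : ℤ × ℤ × ℤ × ℤ} (ht : t ∈ Eset δ X) :
    |(t.2.2.1 : ℝ)| * (t.2.2.2 : ℝ) ^ 2 ≤ 31 * X := by
  have h1 : |(t.1 : ℝ)| ^ 3 ≤ X := by simpa only [Int.cast_abs] using ht.2.2.2.2.1
  have h2 : (t.2.1 : ℝ) ^ 2 ≤ X := ht.2.2.2.2.2.1
  have e : (4 * t.1 ^ 3 + 27 * t.2.1 ^ 2 : ℝ) = t.2.2.1 * t.2.2.2 ^ 2 := by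
    exact_mod_cast ht.2.2.2.2.2.2.2
  rw [← abs_pow] at h1
  rw [← abs_of_nonneg (sq_nonneg (t.2.2.2 : ℝ)), ← abs_mul, ← e]
  have h3 := abs_le.1 h1
  exact abs_le.2 ⟨by nlinarith [sq_nonneg (t.2.1 : ℝ)], by linarith⟩

/-- The number of `(B, ℓ)` for which `(A, B, m, ℓ)` lies in `Eset δ X`, for given `A` and `m`. -/
theorem card_fiber_fst_m_le {δ X : ℝ} (hX : 1 ≤ X) {F : Finset (ℤ × ℤ × ℤ × ℤ)} {A m : ℤ}
    (hF : ∀ t ∈ F, t ∈ Eset δ X ∧ t.1 = A ∧ t.2.2.1 = m) (hA : A ≠ 0) (hm : m ≠ 0)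
    {Q : ℕ} (hQ : 108 * m.natAbs ≤ Q) :
    (F.card : ℝ) ≤ ((108 * A.natAbs ^ 3).divisors.card : ℝ) ^ 2 *
      (1 + 2 * squareDivisorMajorant Q m) *
      (4 * ((⌊27 * X ^ (1 / 2 : ℝ)⌋₊ ^ 2 * (1 + 27 * m.natAbs)).size + 1) : ℕ) := by
  have hinj : Set.InjOn (fun t : ℤ × ℤ × ℤ × ℤ => (27 * t.2.1, t.2.2.2)) F := by
    intro t ht t' ht' heq
    obtain ⟨h1, h2, h3⟩ := hF t ht
    obtain ⟨h1', h2', h3'⟩ := hF t' ht'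
    simp only [Prod.mk.injEq] at heq
    ext
    · rw [h2, h2']
    · omega
    · rw [h3, h3']
    · exact heq.2
  rw [← Finset.card_image_of_injOn hinj]
  have hmain := card_norm_eq_le (S := F.image (fun t : ℤ × ℤ × ℤ × ℤ => (27 * t.2.1, t.2.2.2)))
    (D := 27 * m) (N := -(108 * A ^ 3)) (U := ⌊27 * X ^ (1 / 2 : ℝ)⌋₊)
    (H := squareDivisorMajorant Q m) (by positivity) (by simpa using hA) ?_ ?_ ?_
  · have e1 : (-(108 * A ^ 3)).natAbs = 108 * A.natAbs ^ 3 := by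
      rw [Int.natAbs_neg, Int.natAbs_mul, Int.natAbs_pow]; rfl
    have e2 : (27 * m).natAbs = 27 * m.natAbs := by
      rw [Int.natAbs_mul]; rfl
    rwa [e1, e2] at hmain
  · intro p hp
    obtain ⟨t, ht, rfl⟩ := Finset.mem_image.1 hp
    obtain ⟨h1, h2, h3⟩ := hF t ht
    have e := h1.2.2.2.2.2.2.2
    rw [h2, h3] at e
    linear_combination 27 * e
  · intro p hp
    obtain ⟨t, ht, rfl⟩ := Finset.mem_image.1 hp
    obtain ⟨h1, h2, h3⟩ := hF t ht
    have hfloor : ∀ z : ℤ, |(z : ℝ)| ≤ 27 * X ^ (1 / 2 : ℝ) →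
        |z| ≤ (⌊27 * X ^ (1 / 2 : ℝ)⌋₊ : ℤ) := by
      intro z hz
      rw [Int.abs_eq_natAbs]
      refine Int.ofNat_le.2 (Nat.le_floor ?_)
      rwa [Nat.cast_natAbs, Int.cast_abs]
    refine ⟨hfloor _ ?_, hfloor _ ?_⟩
    · push_cast
      rw [abs_mul, abs_of_pos (by norm_num : (0 : ℝ) < 27)]
      gcongr
      exact Eset_abs_snd_le h1 hX
    · refine le_of_pow_le_pow_left₀ two_ne_zero (by positivity) ?_
      have e : (X ^ (1 / 2 : ℝ)) ^ 2 = X := by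
        rw [← Real.rpow_natCast, ← Real.rpow_mul (by linarith)]
        norm_num
      have h4 := Eset_abs_mul_sq_le h1
      have h5 : (1 : ℝ) ≤ |(t.2.2.1 : ℝ)| := by
        exact_mod_cast Int.one_le_abs h1.2.2.1
      rw [sq_abs, mul_pow, e]
      nlinarith [sq_nonneg (t.2.2.2 : ℝ)]
  · intro h hh
    refine le_squareDivisorMajorant hm hQ ?_
    rwa [show (4 : ℤ) * (27 * m) = 108 * m by ring] at hh

theorem exists_card_large_ell_le :
    ∃ C : ℝ, 0 < C ∧ ∀ δ X : ℝ, 1 ≤ X → ∀ T : Finset (ℤ × ℤ × ℤ × ℤ),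
      (∀ t ∈ T, t ∈ Eset δ X ∧ X ^ (1 / 3 : ℝ) < (t.2.2.2 : ℝ)) →
      (T.card : ℝ) ≤ C * X ^ (25 / 36 : ℝ) := by
  obtain ⟨C, hC, hdiv⟩ := exists_card_divisors_le_rpow (ε := 1 / 180) (by norm_num)
  obtain ⟨S, hS, hsize⟩ := exists_size_le_rpow (ε := 1 / 180) (by norm_num)
  obtain ⟨K, hK, hsum⟩ := exists_sum_squareDivisorMajorant_le (ε := 1 / 180) (by norm_num)
  set k₁ : ℝ := (108 : ℝ) ^ (1 / 180 : ℝ) with hk₁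
  set k₂ : ℝ := (729 * 838 : ℝ) ^ (1 / 180 : ℝ) with hk₂
  set k₃ : ℝ := (3348 : ℝ) ^ (1 / 180 : ℝ) with hk₃
  have hk₁' : 0 < k₁ := by positivity
  have hk₂' : 0 < k₂ := by positivity
  have hk₃' : 0 < k₃ := by positivity
  refine ⟨2 * ((C * k₁) ^ 2 * (4 * (S * k₂)) * (62 + 2 * (K * 31 * k₃))), by positivity,
    fun δ X hX T hT => ?_⟩
  have hX0 : 0 < X := by linarith
  set R := X ^ (1 / 3 : ℝ) with hR
  have hR0 : 0 < R := by positivity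
  have hRX : R ≤ X := Real.rpow_le_self_of_one_le hX (by norm_num)
  have hR3 : R ^ 3 = X := by
    rw [hR, ← Real.rpow_natCast, ← Real.rpow_mul hX0.le]; norm_num
  set E := X ^ (1 / 180 : ℝ) with hE
  have hE1 : 1 ≤ E := Real.one_le_rpow hX (by norm_num)
  set Q := ⌊3348 * R⌋₊ with hQ
  have h31 : 0 ≤ 31 * R := by positivity
  set M := nonzeroIntegers R ×ˢ nonzeroIntegers (31 * R) with hM
  rw [Finset.card_eq_sum_card_fiberwise (f := fun t => (t.1, t.2.2.1)) (t := M)]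
  swap
  · intro t ht
    obtain ⟨h1, h2⟩ := hT t ht
    simp only [hM, Finset.coe_product, Set.mem_prod, Finset.mem_coe, mem_nonzeroIntegers hR0.le,
      mem_nonzeroIntegers h31]
    refine ⟨⟨h1.1, Eset_abs_fst_le h1 hX⟩, h1.2.2.1, ?_⟩
    have h3 := Eset_abs_mul_sq_le h1
    have h4 : |(t.2.2.1 : ℝ)| * R ^ 2 ≤ 31 * R * R ^ 2 := by
      calc |(t.2.2.1 : ℝ)| * R ^ 2 ≤ |(t.2.2.1 : ℝ)| * (t.2.2.2 : ℝ) ^ 2 := by gcongr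
        _ ≤ 31 * X := h3
        _ = _ := by rw [← hR3]; ring
    exact le_of_mul_le_mul_right h4 (by positivity)
  have hterm : ∀ A ∈ nonzeroIntegers R, ∀ m ∈ nonzeroIntegers (31 * R),
      (({t ∈ T | (t.1, t.2.2.1) = (A, m)}.card : ℕ) : ℝ) ≤
      (C * k₁ * E) ^ 2 * (4 * (S * k₂ * E ^ 2)) * (1 + 2 * squareDivisorMajorant Q m) := by
    intro A hA m hm
    rw [mem_nonzeroIntegers hR0.le] at hA
    rw [mem_nonzeroIntegers h31] at hm
    have hmN : ((m.natAbs : ℕ) : ℝ) ≤ 31 * R := by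
      rw [Nat.cast_natAbs, Int.cast_abs]; exact hm.2
    have hAN : ((A.natAbs : ℕ) : ℝ) ≤ R := by
      rw [Nat.cast_natAbs, Int.cast_abs]; exact hA.2
    have hG := squareDivisorMajorant_nonneg Q m
    have h1 := card_fiber_fst_m_le hX (F := {t ∈ T | (t.1, t.2.2.1) = (A, m)})
      (A := A) (m := m) (δ := δ) (Q := Q) (fun t ht => by
        obtain ⟨ht1, ht2⟩ := Finset.mem_filter.1 ht
        simp only [Prod.mk.injEq] at ht2
        exact ⟨(hT t ht1).1, ht2⟩) hA.1 hm.1 (by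
          apply Nat.le_floor
          push_cast
          linarith)
    have hA0 : 0 < A.natAbs := Int.natAbs_pos.2 hA.1
    have h2 : ((108 * A.natAbs ^ 3).divisors.card : ℝ) ≤ C * k₁ * E := by
      refine (hdiv (108 * A.natAbs ^ 3) (by positivity)).trans ?_
      rw [mul_assoc, hk₁, hE, ← Real.mul_rpow (by norm_num) hX0.le]
      gcongr
      push_cast
      rw [← hR3]
      gcongr
    have hU : (⌊27 * X ^ (1 / 2 : ℝ)⌋₊ : ℝ) ^ 2 ≤ 729 * X := by
      have e : (27 * X ^ (1 / 2 : ℝ)) ^ 2 = 729 * X := by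
        rw [mul_pow, ← Real.rpow_natCast (X ^ _), ← Real.rpow_mul hX0.le]
        norm_num
      rw [← e]
      gcongr
      exact Nat.floor_le (by positivity)
    have hU0 : 0 < ⌊27 * X ^ (1 / 2 : ℝ)⌋₊ := by
      have := Real.one_le_rpow hX (by norm_num : (0 : ℝ) ≤ 1 / 2)
      exact Nat.floor_pos.2 (by linarith)
    have h3 : ((⌊27 * X ^ (1 / 2 : ℝ)⌋₊ ^ 2 * (1 + 27 * m.natAbs)).size + 1 : ℕ) ≤
        S * k₂ * E ^ 2 := by
      refine (hsize _ (by positivity)).trans ?_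
      have e : E ^ 2 = (X ^ 2) ^ (1 / 180 : ℝ) := by
        rw [hE, Real.rpow_pow_comm hX0.le]
      rw [mul_assoc, hk₂, e, ← Real.mul_rpow (by norm_num) (by positivity)]
      gcongr
      push_cast
      calc (⌊27 * X ^ (1 / 2 : ℝ)⌋₊ : ℝ) ^ 2 * (1 + 27 * (m.natAbs : ℝ))
          ≤ 729 * X * (838 * X) := by gcongr; linarith
        _ = _ := by ring
    have h4 : ((4 * ((⌊27 * X ^ (1 / 2 : ℝ)⌋₊ ^ 2 * (1 + 27 * m.natAbs)).size + 1) : ℕ) : ℝ) ≤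
        4 * (S * k₂ * E ^ 2) := by
      rw [Nat.cast_mul]
      exact mul_le_mul_of_nonneg_left h3 (by norm_num)
    calc _ ≤ _ := h1
      _ ≤ (C * k₁ * E) ^ 2 * (1 + 2 * squareDivisorMajorant Q m) * (4 * (S * k₂ * E ^ 2)) := by
        gcongr
      _ = _ := by ring
  have hmsum : ∑ m ∈ nonzeroIntegers (31 * R), (1 + 2 * squareDivisorMajorant Q m) ≤
      (62 + 2 * (K * 31 * k₃)) * (R * E) := by
    have h1 := card_nonzeroIntegers_le h31
    have h2 := hsum (31 * R) Q h31
    have h3 : (Q : ℝ) ^ (1 / 180 : ℝ) ≤ k₃ * E := by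
      rw [hk₃, hE, ← Real.mul_rpow (by norm_num) hX0.le]
      gcongr
      exact (Nat.floor_le (by positivity)).trans (by linarith)
    rw [Finset.sum_add_distrib, Finset.sum_const, nsmul_eq_mul, mul_one, ← Finset.mul_sum]
    have h4 : K * (31 * R) * (Q : ℝ) ^ (1 / 180 : ℝ) ≤ K * (31 * R) * (k₃ * E) := by gcongr
    have h5 : R ≤ R * E := le_mul_of_one_le_right hR0.le hE1
    nlinarith
  have hpow : R * R * E ^ 5 = X ^ (25 / 36 : ℝ) := by
    rw [hR, hE, ← Real.rpow_natCast, ← Real.rpow_mul hX0.le, ← Real.rpow_add hX0,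
      ← Real.rpow_add hX0]
    norm_num
  rw [Nat.cast_sum]
  calc _ ≤ ∑ p ∈ M, (C * k₁ * E) ^ 2 * (4 * (S * k₂ * E ^ 2)) *
        (1 + 2 * squareDivisorMajorant Q p.2) :=
        Finset.sum_le_sum fun p hp =>
          hterm p.1 (Finset.mem_product.1 hp).1 p.2 (Finset.mem_product.1 hp).2
    _ = (C * k₁ * E) ^ 2 * (4 * (S * k₂ * E ^ 2)) * ((nonzeroIntegers R).card *
        ∑ m ∈ nonzeroIntegers (31 * R), (1 + 2 * squareDivisorMajorant Q m)) := by
        rw [← Finset.mul_sum, hM, Finset.sum_product]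
        simp only [Finset.sum_const, nsmul_eq_mul]
    _ ≤ (C * k₁ * E) ^ 2 * (4 * (S * k₂ * E ^ 2)) *
        (2 * R * ((62 + 2 * (K * 31 * k₃)) * (R * E))) := by
        gcongr
        · exact Finset.sum_nonneg fun m _ => by linarith [squareDivisorMajorant_nonneg Q m]
        · exact card_nonzeroIntegers_le hR0.le
    _ = 2 * ((C * k₁) ^ 2 * (4 * (S * k₂)) * (62 + 2 * (K * 31 * k₃))) * (R * R * E ^ 5) := by
        ring
    _ = _ := by rw [hpow]

/-- `#𝓔_δ(X) ≪ X^{5/6 - 5δ/6}` for fixed `δ ∈ (0, 1/6)`. -/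
theorem Eset_count (δ : ℝ) (hδ : δ ∈ Set.Ioo (0 : ℝ) (1 / 6)) :
    ∃ C : ℝ, 0 < C ∧ ∀ X : ℝ, 1 ≤ X →
      (Nat.card {t : ℤ × ℤ × ℤ × ℤ // t ∈ Eset δ X} : ℝ) ≤ C * X ^ (5 / 6 - 5 * δ / 6) := by
  obtain ⟨C₁, hC₁, h₁⟩ := exists_card_small_ell_le hδ
  obtain ⟨C₂, hC₂, h₂⟩ := exists_card_large_ell_le
  refine ⟨C₁ + C₂, by positivity, fun X hX => ?_⟩
  rcases (Eset δ X).finite_or_infinite with hfin | hinf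
  · have hcard : Nat.card {t : ℤ × ℤ × ℤ × ℤ // t ∈ Eset δ X} = hfin.toFinset.card := by
      rw [← Set.ncard_eq_toFinset_card _ hfin]
      rfl
    have hle : X ^ (25 / 36 : ℝ) ≤ X ^ (5 / 6 - 5 * δ / 6) :=
      Real.rpow_le_rpow_of_exponent_le hX (by linarith [hδ.2])
    have hs := h₁ X hX {t ∈ hfin.toFinset | (t.2.2.2 : ℝ) ≤ X ^ (1 / 3 : ℝ)} fun t ht => by
      simpa using ht
    have hl := h₂ δ X hX {t ∈ hfin.toFinset | ¬ (t.2.2.2 : ℝ) ≤ X ^ (1 / 3 : ℝ)} fun t ht => by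
      simpa using ht
    rw [hcard, ← Finset.card_filter_add_card_filter_not
      (s := hfin.toFinset) (fun t => (t.2.2.2 : ℝ) ≤ X ^ (1 / 3 : ℝ))]
    push_cast
    nlinarith
  · have : Infinite {t : ℤ × ℤ × ℤ × ℤ // t ∈ Eset δ X} := hinf.to_subtype
    rw [Nat.card_eq_zero_of_infinite]
    push_cast
    positivity
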